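/- arXiv:2309.08057 — 2 statements merged into one kernel-verified Lean document; each statement's English description precedes it below -/
import Mathlib

section
/- Fix K > 1 and t > 2π, let φ satisfy the smoothing conditions, and set R(a,b) = R₁(a,b) + R₂(a,b;t) (defined for complex a, b with a, b, a+b, a−b nonzero and |a|, |b| sufficiently small). Then the iterated limit lim_{a→0} lim_{b→a} R(a,b) exists and equals Σ_{j=0}^{4} Q_j(log K, log(t/(2π))). -/
open Complex MeasureTheory Filter Finset Set
open scoped Real Topology BigOperators

noncomputable section

namespace CHN

/-- `φ` satisfies the smoothing conditions with parameter `μ`. -/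
structure SmoothingFn (μ : ℝ) (φ : ℝ → ℝ) : Prop where
  smooth : ContDiff ℝ (⊤ : ℕ∞) φ
  nonneg : ∀ t : ℝ, 0 ≤ φ t
  eq_one : ∀ t : ℝ, 0 ≤ t → t ≤ 1 → φ t = 1
  eq_zero : ∀ t : ℝ, 1 + μ ≤ t → φ t = 0
  deriv_bound : ∀ j : ℕ, ∃ C : ℝ, 0 < C ∧ ∀ t : ℝ, |iteratedDeriv j φ t| ≤ C * μ⁻¹ ^ j

/-- `ω` is an admissible weight function for `T` with parameter `ν`, support constants
`c₁ < c₂`, derivative constants `Cd`, and scale `T₀` with `T ^ ν ≤ T₀ ≪ T`. -/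
structure AdmissibleWeight (c₁ c₂ ν : ℝ) (Cd : ℕ → ℝ) (T T₀ : ℝ) (ω : ℝ → ℂ) : Prop where
  hc₁ : 0 < c₁
  hc₁₂ : c₁ < c₂
  smooth : ContDiff ℝ (⊤ : ℕ∞) ω
  supp : ∀ t : ℝ, ω t ≠ 0 → c₁ * T ≤ t ∧ t ≤ c₂ * T
  hT₀_low : T ^ ν ≤ T₀
  hT₀_high : T₀ ≤ T
  deriv_bound : ∀ (j : ℕ) (t : ℝ), ‖iteratedDeriv j ω t‖ ≤ Cd j * T₀⁻¹ ^ j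

/-- The Fourier transform `ŵ(u) = ∫ ω(t) e^{-2πiut} dt`. -/
def fhat (ω : ℝ → ℂ) (u : ℝ) : ℂ :=
  ∫ t : ℝ, ω t * Complex.exp (-2 * (Real.pi : ℂ) * Complex.I * (u : ℂ) * (t : ℂ))

/-- `f(s) = s ζ(1+s)`, extended by `f(0) = 1`. -/
def fzeta (s : ℂ) : ℂ := if s = 0 then 1 else s * riemannZeta (1 + s)

/-- `h(s) = 1/ζ(2+s)`. -/
def hzeta (s : ℂ) : ℂ := (riemannZeta (2 + s))⁻¹

/-- `H(s) = -ζ′(2+s)/ζ(2+s)²`. -/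
def Hfun (s : ℂ) : ℂ := -deriv riemannZeta (2 + s) / (riemannZeta (2 + s)) ^ 2

/-- `F(s) = s² ζ′(1+s)`. -/
def Ffun (s : ℂ) : ℂ := s ^ 2 * deriv riemannZeta (1 + s)

/-- `G(s) = -2 ∫₀^∞ φ(t) φ′(t) t^s dt`. -/
def Gfun (φ : ℝ → ℝ) (s : ℂ) : ℂ :=
  -2 * ∫ t in Set.Ioi (0 : ℝ), ((φ t * deriv φ t : ℝ) : ℂ) * (t : ℂ) ^ s

/-- `Φ₂(s) = ∫₀^∞ φ(t)² t^{s-1} dt`. -/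
def Phi2 (φ : ℝ → ℝ) (s : ℂ) : ℂ :=
  ∫ t in Set.Ioi (0 : ℝ), ((φ t ^ 2 : ℝ) : ℂ) * (t : ℂ) ^ (s - 1)

/-- The Mellin transform `Φ(s) = ∫₀^∞ φ(t) t^{s-1} dt`. -/
def MellinPhi (φ : ℝ → ℝ) (s : ℂ) : ℂ :=
  ∫ t in Set.Ioi (0 : ℝ), ((φ t : ℝ) : ℂ) * (t : ℂ) ^ (s - 1)

/-- Taylor coefficients `g_j` of `f(s) = sζ(1+s)` at `s = 0`. -/
def gcoef (j : ℕ) : ℂ := iteratedDeriv j fzeta 0 / (Nat.factorial j : ℂ)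

/-- Taylor coefficients `δ_j` of `1/ζ(2+s)` at `s = 0`. -/
def dcoef (j : ℕ) : ℂ := iteratedDeriv j hzeta 0 / (Nat.factorial j : ℂ)

/-- Taylor coefficients `c_j` of `G(s)` at `s = 0`. -/
def ccoef (φ : ℝ → ℝ) (j : ℕ) : ℂ := iteratedDeriv j (Gfun φ) 0 / (Nat.factorial j : ℂ)

/-- The polynomials `Q_j(x,y)`, for `0 ≤ j ≤ 4` (and `0` for `j ≥ 5`). -/
def Qpoly (φ : ℝ → ℝ) (j : ℕ) (x y : ℝ) : ℂ :=
  let g : ℕ → ℂ := gcoef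
  let δ : ℕ → ℂ := dcoef
  let c : ℕ → ℂ := ccoef φ
  let X : ℂ := (x : ℂ)
  let Y : ℂ := (y : ℂ)
  match j with
  | 0 => 16*δ 4 - 16*δ 1*g 3 + 32*δ 3*g 1 + 32*(g 1)^2*δ 2 - 24*δ 0*g 4 + 8*(g 2)^2*δ 0
       + 5*δ 0*(g 1)^4 + 16*δ 1*(g 1)^3 - 8*δ 0*g 1*g 3 + 16*δ 1*g 1*g 2 + 12*δ 0*(g 1)^2*g 2
       + 12*(g 1)^2*δ 1*c 1 + 12*δ 0*g 1*g 2*c 1 + 8*δ 3*c 1 + 4*δ 0*(g 1)^3*c 1 + 4*δ 0*g 3*c 1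
       + 8*δ 1*g 2*c 1 + 16*g 1*δ 2*c 1 - 4*δ 2*c 2 - 6*(g 1)^2*δ 0*c 2 - 4*δ 0*g 2*c 2
       - 8*g 1*δ 1*c 2 + 4*g 1*δ 0*c 3 + 2*δ 1*c 3 - δ 0*c 4
  | 1 => (4*δ 0*g 3 + 12*δ 0*g 1*g 2 + 4*δ 0*(g 1)^3 + 8*δ 1*g 2 + 12*δ 1*(g 1)^2 + 16*δ 2*g 1
       + 8*δ 3 - 4*c 1*δ 0*g 2 - 6*c 1*δ 0*(g 1)^2 - 8*c 1*δ 1*g 1 - 4*c 1*δ 2 + 4*c 2*δ 0*g 1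
       + 2*c 2*δ 1 - c 3*δ 0) * X
       + (-12*δ 0*g 3 - 4*δ 0*g 1*g 2 - 8*δ 1*g 2 + 4*δ 1*(g 1)^2 + 4*δ 0*(g 1)^3
       + 8*c 1*δ 0*g 2 + 12*c 1*δ 0*(g 1)^2 + 16*c 1*δ 1*g 1 + 8*c 1*δ 2 - 8*c 2*δ 0*g 1
       - 4*c 2*δ 1 + 2*c 3*δ 0) * Y
  | 2 => (-2*δ 0*g 2 - 3*δ 0*(g 1)^2 - 4*δ 1*g 1 - 2*δ 2 + 2*c 1*δ 0*g 1 + c 1*δ 1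
       - c 2*δ 0/2) * X^2
       + (8*δ 0*g 2 + 12*δ 0*(g 1)^2 + 16*δ 1*g 1 + 8*δ 2 - 8*c 1*δ 0*g 1 - 4*c 1*δ 1
       + 2*c 2*δ 0) * X*Y
       + (-5*δ 0*(g 1)^2 - 4*δ 2 - 6*δ 0*g 2 - 8*δ 1*g 1 + 8*c 1*δ 0*g 1 + 4*c 1*δ 1
       - 2*c 2*δ 0) * Y^2
  | 3 => (2*δ 0*g 1/3 + δ 1/3 - c 1*δ 0/6) * X^3 + (-4*δ 0*g 1 - 2*δ 1 + c 1*δ 0) * X^2*Y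
       + (8*δ 0*g 1 + 4*δ 1 - 2*c 1*δ 0) * X*Y^2 + (-4*δ 0*g 1 - 2*δ 1 + 4*c 1*δ 0/3) * Y^3
  | 4 => (1/(24 * riemannZeta 2)) * (-X^4 + 8*X^3*Y - 24*X^2*Y^2 + 32*X*Y^3 - 14*Y^4)
  | _ => 0

/-- The smoothed Dirichlet polynomial `Σ_{n≥1} τ₂(n) n^{-1/2-it} φ(n/K)`. -/
def tau2Poly (φ : ℝ → ℝ) (K : ℝ) (t : ℝ) : ℂ :=
  ∑' n : ℕ, ((Nat.divisors (n+1)).card : ℂ) *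
    ((n+1 : ℕ) : ℂ) ^ (-(1/2 : ℂ) - Complex.I * (t : ℂ)) * ((φ (((n : ℝ)+1)/K) : ℝ) : ℂ)

/-- `D_{2,2;ω}(K) = ∫ ω(t) |Σ_{n≥1} τ₂(n) n^{-1/2-it} φ(n/K)|² dt`. -/
def D22 (φ : ℝ → ℝ) (ω : ℝ → ℂ) (K : ℝ) : ℂ :=
  ∫ t : ℝ, ω t * ((‖tau2Poly φ K t‖ ^ 2 : ℝ) : ℂ)

/-- The shifted divisor function `σ_A(n)` for a tuple of shifts `A = (a_1, …, a_k)`. -/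
def sigmaShift {k : ℕ} (a : Fin k → ℂ) (n : ℕ) : ℂ :=
  ∑ d : Fin k → Fin (n+1), if (∏ i, (d i : ℕ)) = n then ∏ i, ((d i : ℕ) : ℂ) ^ (-a i) else 0

/-- The Ramanujan sum `c_q(r) = Σ_{d ∣ (q, r)} μ(q/d) d`. -/
def ramanujanC (q : ℕ) (r : ℤ) : ℂ :=
  ∑ d ∈ (Nat.gcd q r.natAbs).divisors, ((ArithmeticFunction.moebius (q / d) : ℤ) : ℂ) * (d : ℂ)

/-- The multiplicative function `g_A(s, n)`. -/
def gA {k : ℕ} (a : Fin k → ℂ) (s : ℂ) (n : ℕ) : ℂ :=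
  ∏ p ∈ n.primeFactors,
    (∑' j : ℕ, sigmaShift a (p ^ (j + n.factorization p)) * (p : ℂ) ^ (-(j : ℂ) * s)) /
    (∑' j : ℕ, sigmaShift a (p ^ j) * (p : ℂ) ^ (-(j : ℂ) * s))

/-- The function `G_A(s, n)`. -/
def GA {k : ℕ} (a : Fin k → ℂ) (s : ℂ) (n : ℕ) : ℂ :=
  ∑ d ∈ n.divisors, ((ArithmeticFunction.moebius d : ℤ) : ℂ) * (d : ℂ) ^ s / (Nat.totient d : ℂ) *
    ∑ e ∈ d.divisors, ((ArithmeticFunction.moebius e : ℤ) : ℂ) / (e : ℂ) ^ s * gA a s (n * e / d)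

/-- The shifted convolution sum `D_{F;I,J}(r) = Σ_{m-n=r} σ_I(m) σ_J(n) F(m,n)`. -/
def DFsum {k l : ℕ} (a : Fin k → ℂ) (b : Fin l → ℂ) (F : ℝ → ℝ → ℂ) (r : ℤ) : ℂ :=
  ∑' n : ℕ, if 0 < (n : ℤ) + 1 + r then
      sigmaShift a ((n : ℤ) + 1 + r).toNat * sigmaShift b (n + 1) *
        F ((n : ℝ) + 1 + (r : ℝ)) ((n : ℝ) + 1)
    else 0

/-- The main term in the additive divisor conjecture. -/
def ADMain {k l : ℕ} (a : Fin k → ℂ) (b : Fin l → ℂ) (F : ℝ → ℝ → ℂ) (r : ℤ) : ℂ :=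
  ∑ i₁ : Fin k, ∑ i₂ : Fin l,
    (∏ j₁ ∈ Finset.univ.erase i₁, riemannZeta (1 - a i₁ + a j₁)) *
    (∏ j₂ ∈ Finset.univ.erase i₂, riemannZeta (1 - b i₂ + b j₂)) *
    (∑' q : ℕ, ramanujanC (q + 1) r * GA a (1 - a i₁) (q + 1) * GA b (1 - b i₂) (q + 1) *
        ((q + 1 : ℕ) : ℂ) ^ (a i₁ + b i₂ - 2)) *
    ∫ x in Set.Ioi (max 0 (r : ℝ)),
      F x (x - (r : ℝ)) * (x : ℂ) ^ (-a i₁) * ((x - (r : ℝ) : ℝ) : ℂ) ^ (-b i₂)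

/-- The additive divisor hypothesis `AD_{k,ℓ}(θ, C, β)`. -/
def AD (k l : ℕ) (θ C β : ℝ) : Prop :=
  ∀ ε : ℝ, 0 < ε → ∀ κ : ℝ, 1 ≤ κ → ∀ Dc : ℕ → ℕ → ℝ,
  ∃ C' : ℝ, 0 < C' ∧ ∃ X₀ : ℝ, ∀ P : ℝ, 1 < P → ∀ X Y : ℝ, X₀ ≤ X → 1/2 < Y →
    X ≤ κ * Y → Y ≤ κ * X →
  ∀ F : ℝ → ℝ → ℂ, ContDiff ℝ (⊤ : ℕ∞) (fun p : ℝ × ℝ => F p.1 p.2) →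
    (∀ x y : ℝ, F x y ≠ 0 → (X ≤ x ∧ x ≤ 2 * X) ∧ (Y ≤ y ∧ y ≤ 2 * Y)) →
    (∀ m n : ℕ, ∀ x y : ℝ,
      |x| ^ m * |y| ^ n * ‖iteratedDeriv m (fun x' => iteratedDeriv n (fun y' => F x' y') y) x‖
        ≤ Dc m n * P ^ (m + n)) →
  ∀ a : Fin k → ℂ, ∀ b : Fin l → ℂ, Function.Injective a → Function.Injective b →
    (∀ i, ‖a i‖ ≤ κ / Real.log X) → (∀ j, ‖b j‖ ≤ κ / Real.log X) →
  ∀ r : ℤ, 1 ≤ r.natAbs → (r.natAbs : ℝ) ≤ κ * X ^ β →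
    ‖DFsum a b F r - ADMain a b F r‖ ≤ C' * P ^ C * X ^ (θ + ε)

/-- The mean value `D_{I,J;ω}(K)` of long Dirichlet polynomials with shifted
divisor coefficients. -/
def DmeanShift {k l : ℕ} (a : Fin k → ℂ) (b : Fin l → ℂ) (φ : ℝ → ℝ) (ω : ℝ → ℂ)
    (K : ℝ) : ℂ :=
  ∫ t : ℝ, ω t *
    (∑' n : ℕ, sigmaShift a (n+1) * ((n+1 : ℕ) : ℂ) ^ (-(1/2 : ℂ) - Complex.I * (t : ℂ)) *
      ((φ (((n : ℝ)+1)/K) : ℝ) : ℂ)) *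
    (∑' n : ℕ, sigmaShift b (n+1) * ((n+1 : ℕ) : ℂ) ^ (-(1/2 : ℂ) + Complex.I * (t : ℂ)) *
      ((φ (((n : ℝ)+1)/K) : ℝ) : ℂ))

/-- `Z(I,J) = Π_{i,j} ζ(1 + a_i + b_j)`. -/
def Zfun {k l : ℕ} (a : Fin k → ℂ) (b : Fin l → ℂ) : ℂ :=
  ∏ i : Fin k, ∏ j : Fin l, riemannZeta (1 + a i + b j)

/-- The Euler product `A(I,J)`. -/
def AEuler {k l : ℕ} (a : Fin k → ℂ) (b : Fin l → ℂ) : ℂ :=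
  ∏' p : Nat.Primes,
    ((∏ i : Fin k, ∏ j : Fin l, (1 - ((p : ℕ) : ℂ) ^ (-(1 : ℂ) - a i - b j))) *
      ∑' u : ℕ, sigmaShift a ((p : ℕ) ^ u) * sigmaShift b ((p : ℕ) ^ u) /
        (((p : ℕ) ^ u : ℕ) : ℂ))

/-- `B(I,J) = A(I,J) Z(I,J)`. -/
def BEuler {k l : ℕ} (a : Fin k → ℂ) (b : Fin l → ℂ) : ℂ := AEuler a b * Zfun a b

/-- The contour integral `∫_{(c)} f(s) ds`, parametrized by `s = c + iu`. -/
def lineInt (c : ℝ) (f : ℂ → ℂ) : ℂ :=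
  ∫ u : ℝ, f ((c : ℂ) + (u : ℂ) * Complex.I) * Complex.I

/-- The diagonal main term `M₀(K)`. -/
def M0 {k l : ℕ} (a : Fin k → ℂ) (b : Fin l → ℂ) (φ : ℝ → ℝ) (ω : ℝ → ℂ) (K c : ℝ) : ℂ :=
  fhat ω 0 / (2 * (Real.pi : ℂ) * Complex.I) *
    lineInt c (fun s => (K : ℂ) ^ s * Phi2 φ s * BEuler (fun i => a i + s) b)

/-- The off-diagonal main term `M₁(K)`. -/
def M1 {k l : ℕ} (a : Fin k → ℂ) (b : Fin l → ℂ) (φ : ℝ → ℝ) (ω : ℝ → ℂ) (K c : ℝ) : ℂ :=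
  ∫ t in Set.Ioi (0 : ℝ), ω t *
    ∑ i : Fin k, ∑ j : Fin l,
      ((t / (2 * Real.pi) : ℝ) : ℂ) ^ (-a i - b j) *
      (∏ i' ∈ Finset.univ.erase i, riemannZeta (1 + a i' - a i)) *
      (∏ j' ∈ Finset.univ.erase j, riemannZeta (1 + b j' - b j)) *
      ((2 * (Real.pi : ℂ) * Complex.I)⁻¹ *
        lineInt c (fun s =>
          Phi2 φ s * ((2 * Real.pi * K / t : ℝ) : ℂ) ^ s *
          (∏ i' ∈ Finset.univ.erase i, ∏ j' ∈ Finset.univ.erase j,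
            riemannZeta (1 + (a i' + s) + b j')) *
          riemannZeta (1 - a i - b j - s) *
          AEuler (Function.update a i (-b j - s))
                 (Function.update (fun j' => b j' + s) j (-a i))))

end CHN

namespace CHN

/-- Euler's constant `γ₀` as a complex number. -/
def eulerγ : ℂ := (Real.eulerMascheroniConstant : ℂ)

/-- The term `R₁(a,b)` from Proposition `M₀`. -/
def R1 (φ : ℝ → ℝ) (K : ℝ) (a b : ℂ) : ℂ :=
  ((Real.log K : ℂ) + ccoef φ 1 + eulerγ) *
      (fzeta (a+b)/(a+b)) * (fzeta a / a) * (fzeta b / b) * hzeta (a+b)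
  + 2 * (fzeta (a+b)/(a+b)) * (fzeta a / a) * (fzeta b / b) * Hfun (a+b)
  + (deriv fzeta (a+b)/(a+b) - fzeta (a+b)/(a+b)^2) * (fzeta a / a) * (fzeta b / b) * hzeta (a+b)
  + (fzeta (a+b)/(a+b)) * (deriv fzeta a / a - fzeta a / a^2) * (fzeta b / b) * hzeta (a+b)
  + (fzeta (a+b)/(a+b)) * (fzeta a / a) * (deriv fzeta b / b - fzeta b / b^2) * hzeta (a+b)

/-- The term `R₁′(a,b)`. -/
def R1' (φ : ℝ → ℝ) (K : ℝ) (a b : ℂ) : ℂ :=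
  (a^2)⁻¹ * Gfun φ (-a) * (K : ℂ)^(-a) * (fzeta b / b) * (fzeta (b-a)/(b-a)) *
      fzeta (-a) * hzeta (b-a)
  + (b^2)⁻¹ * Gfun φ (-b) * (K : ℂ)^(-b) * (fzeta a / a) * (fzeta (a-b)/(a-b)) *
      fzeta (-b) * hzeta (a-b)
  + ((a+b)^2)⁻¹ * Gfun φ (-(a+b)) * (K : ℂ)^(-(a+b)) * (fzeta (-b) / b) * (fzeta (-a) / a) *
      fzeta (-(a+b)) * hzeta (-(a+b))

/-- The term `R₂(a,b;t)`. -/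
def R2 (φ : ℝ → ℝ) (K : ℝ) (a b : ℂ) (t : ℝ) : ℂ :=
  let X : ℂ := (Real.log (2 * Real.pi * K / t) : ℂ)
  let g₁ : ℂ := eulerγ
  let c₁ : ℂ := ccoef φ 1
  (-(((2*Real.pi/t : ℝ) : ℂ)^(a+b) * hzeta (-(a+b)) * (fzeta (-a)/a) * (fzeta (-b)/b) *
      (Ffun (-(a+b))/(a+b)^2 + (fzeta (-(a+b))/(a+b)) * (X + g₁ + c₁)))
  + ((2*Real.pi/t : ℝ) : ℂ)^a * hzeta (b-a) * ((fzeta (-a))^2/a^2) * ((fzeta b)^2/b^2)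
  + ((2*Real.pi/t : ℝ) : ℂ)^b * hzeta (a-b) * ((fzeta (-b))^2/b^2) * ((fzeta a)^2/a^2)
  - hzeta (a+b) * (fzeta a / a) * (fzeta b / b) *
      (Ffun (a+b)/(a+b)^2 + (fzeta (a+b)/(a+b)) * (X - g₁ + c₁))
  + (K : ℂ)^(-b) * ((2*Real.pi/t : ℝ) : ℂ)^(a-b) * hzeta (b-a) * (Gfun φ (-b)/b) *
      (fzeta (b-a)/(b-a)) * (fzeta (-a)/a) * (fzeta b / b)
  + (K : ℂ)^(-a) * ((2*Real.pi/t : ℝ) : ℂ)^(b-a) * hzeta (a-b) * (Gfun φ (-a)/a) *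
      (fzeta (a-b)/(a-b)) * (fzeta a / a) * (fzeta (-b)/b)
  - (K : ℂ)^(-(a+b)) * ((2*Real.pi/t : ℝ) : ℂ)^(-(a+b)) * hzeta (a+b) *
      (Gfun φ (-(a+b))/(a+b)) * (fzeta (a+b)/(a+b)) * (fzeta a / a) * (fzeta b / b))

/-- `I₁₁(s,t)`. -/
def I11 (φ : ℝ → ℝ) (K : ℝ) (a b : ℂ) (s : ℂ) (t : ℝ) : ℂ :=
  (s^2)⁻¹ * Gfun φ s * (K : ℂ)^s * ((2*Real.pi/t : ℝ) : ℂ)^(a+b+s) *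
    riemannZeta (1-a-b-s) * fzeta s / riemannZeta (2-a-b)

/-- `I₁₂(s,t)`. -/
def I12 (φ : ℝ → ℝ) (K : ℝ) (a b : ℂ) (s : ℂ) (t : ℝ) : ℂ :=
  s⁻¹ * Gfun φ s * (K : ℂ)^s * ((2*Real.pi/t : ℝ) : ℂ)^(a+s) *
    riemannZeta (1-a-s) * riemannZeta (1+b+s) / riemannZeta (2+b-a)

/-- `I₂₁(s,t)`. -/
def I21 (φ : ℝ → ℝ) (K : ℝ) (a b : ℂ) (s : ℂ) (t : ℝ) : ℂ :=
  s⁻¹ * Gfun φ s * (K : ℂ)^s * ((2*Real.pi/t : ℝ) : ℂ)^(b+s) *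
    riemannZeta (1-b-s) * riemannZeta (1+a+s) / riemannZeta (2+a-b)

/-- `I₂₂(s,t)`. -/
def I22 (φ : ℝ → ℝ) (K : ℝ) (a b : ℂ) (s : ℂ) (t : ℝ) : ℂ :=
  -(s^2)⁻¹ * Gfun φ s * (K : ℂ)^s * ((2*Real.pi/t : ℝ) : ℂ)^s *
    riemannZeta (1+a+b+s) * fzeta (-s) / riemannZeta (2+a+b)

end CHN

namespace CHN

def Jet (F : ℂ → ℂ) (p0 p1 p2 p3 p4 : ℂ) : Prop :=
  (fun a => F a - (p0 + p1 * a + p2 * a^2 + p3 * a^3 + p4 * a^4)) =O[𝓝 0] (fun a : ℂ => a^5)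

lemma isBigO_mul_cont {F G H : ℂ → ℂ} (hF : F =O[𝓝 0] H) (hG : ContinuousAt G 0) :
    (fun a => F a * G a) =O[𝓝 0] H := by
  have h1 : G =O[𝓝 0] (fun _ => (1:ℂ)) := hG.isBigO_one ℂ
  simpa using hF.mul h1

lemma Jet.add {F G : ℂ → ℂ} {p0 p1 p2 p3 p4 q0 q1 q2 q3 q4 : ℂ} (hF : Jet F p0 p1 p2 p3 p4)
    (hG : Jet G q0 q1 q2 q3 q4) :
    Jet (fun a => F a + G a) (p0+q0) (p1+q1) (p2+q2) (p3+q3) (p4+q4) := by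
  unfold Jet at *
  refine (Asymptotics.IsBigO.add hF hG).congr_left fun a => by ring

lemma Jet.sub {F G : ℂ → ℂ} {p0 p1 p2 p3 p4 q0 q1 q2 q3 q4 : ℂ} (hF : Jet F p0 p1 p2 p3 p4)
    (hG : Jet G q0 q1 q2 q3 q4) :
    Jet (fun a => F a - G a) (p0-q0) (p1-q1) (p2-q2) (p3-q3) (p4-q4) := by
  unfold Jet at *
  refine (Asymptotics.IsBigO.sub hF hG).congr_left fun a => by ring

lemma Jet.smul {F : ℂ → ℂ} {p0 p1 p2 p3 p4 : ℂ} (c : ℂ) (hF : Jet F p0 p1 p2 p3 p4) :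
    Jet (fun a => c * F a) (c*p0) (c*p1) (c*p2) (c*p3) (c*p4) := by
  unfold Jet at *
  refine (hF.const_mul_left c).congr_left fun a => by ring

lemma Jet.shift {F : ℂ → ℂ} {p0 p1 p2 p3 p4 : ℂ} (hF : Jet F p0 p1 p2 p3 p4) :
    Jet (fun a => a * F a) 0 p0 p1 p2 p3 := by
  unfold Jet at *
  have h1 := isBigO_mul_cont hF (G := fun a => a) continuousAt_id
  have h2 : (fun a : ℂ => a^5 * p4) =O[𝓝 0] (fun a : ℂ => a^5) :=
    isBigO_mul_cont (Asymptotics.isBigO_refl _ _) continuousAt_const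
  refine (h1.add h2).congr_left fun a => by ring

lemma Jet.mul {F G : ℂ → ℂ} {p0 p1 p2 p3 p4 q0 q1 q2 q3 q4 : ℂ} (hF : Jet F p0 p1 p2 p3 p4)
    (hG : Jet G q0 q1 q2 q3 q4) :
    Jet (fun a => F a * G a) (p0*q0) (p0*q1+p1*q0) (p0*q2+p1*q1+p2*q0)
      (p0*q3+p1*q2+p2*q1+p3*q0) (p0*q4+p1*q3+p2*q2+p3*q1+p4*q0) := by
  unfold Jet at *
  have b5 : (fun a : ℂ => a^5) =O[𝓝 0] (fun _ => (1:ℂ)) :=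
    (by fun_prop : ContinuousAt (fun a : ℂ => a^5) 0).isBigO_one ℂ
  have h1 := isBigO_mul_cont hF (G := fun a => q0 + q1 * a + q2 * a^2 + q3 * a^3 + q4 * a^4)
    (by fun_prop)
  have h2 := isBigO_mul_cont hG (G := fun a => p0 + p1 * a + p2 * a^2 + p3 * a^3 + p4 * a^4)
    (by fun_prop)
  have h3 := hF.mul (hG.trans b5)
  simp only [mul_one] at h3
  have h4 : (fun a : ℂ => a^5 * ((p1*q4+p2*q3+p3*q2+p4*q1) + (p2*q4+p3*q3+p4*q2)*a
      + (p3*q4+p4*q3)*a^2 + p4*q4*a^3)) =O[𝓝 0] (fun a : ℂ => a^5) :=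
    isBigO_mul_cont (Asymptotics.isBigO_refl _ _) (by fun_prop)
  refine (((h1.add h2).add h3).add h4).congr_left fun a => by ring

lemma Jet.scale {F : ℂ → ℂ} {p0 p1 p2 p3 p4 : ℂ} (l : ℂ) (hF : Jet F p0 p1 p2 p3 p4) :
    Jet (fun a => F (l*a)) p0 (p1*l) (p2*l^2) (p3*l^3) (p4*l^4) := by
  unfold Jet at *
  have ht : Tendsto (fun a : ℂ => l * a) (𝓝 0) (𝓝 0) := by
    have : ContinuousAt (fun a : ℂ => l * a) 0 := by fun_prop
    simpa [ContinuousAt] using this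
  have h1 := hF.comp_tendsto ht
  have h2 : (fun a : ℂ => (l*a)^5) =O[𝓝 0] (fun a : ℂ => a^5) := by
    have := isBigO_mul_cont (Asymptotics.isBigO_refl (fun a : ℂ => a^5) (𝓝 0))
      (G := fun _ => l^5) continuousAt_const
    exact this.congr_left fun a => by ring
  refine (h1.trans h2).congr_left fun a => by simp only [Function.comp]; ring

lemma Jet.of_analytic {F : ℂ → ℂ} (hF : AnalyticAt ℂ F 0) :
    Jet F (iteratedDeriv 0 F 0 / (Nat.factorial 0 : ℂ)) (iteratedDeriv 1 F 0 / (Nat.factorial 1 : ℂ))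
      (iteratedDeriv 2 F 0 / (Nat.factorial 2 : ℂ)) (iteratedDeriv 3 F 0 / (Nat.factorial 3 : ℂ))
      (iteratedDeriv 4 F 0 / (Nat.factorial 4 : ℂ)) := by
  have h := hF.hasFPowerSeriesAt.isBigO_sub_partialSum_pow 5
  unfold Jet
  have h2 := h.trans (Asymptotics.isBigO_of_le (g := fun a : ℂ => a^5) _ (by intro a; simp))
  refine h2.congr_left fun a => ?_
  simp [FormalMultilinearSeries.partialSum, Finset.sum_range_succ, zero_add,
    smul_eq_mul]
  ring

lemma Jet.of_deriv {F : ℂ → ℂ} (hF : AnalyticAt ℂ F 0) :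
    Jet (fun a => a * deriv F a) 0 (iteratedDeriv 1 F 0 / (Nat.factorial 1 : ℂ))
      (2 * (iteratedDeriv 2 F 0 / (Nat.factorial 2 : ℂ))) (3 * (iteratedDeriv 3 F 0 / (Nat.factorial 3 : ℂ)))
      (4 * (iteratedDeriv 4 F 0 / (Nat.factorial 4 : ℂ))) := by
  have h := (Jet.of_analytic hF.deriv).shift
  simp only [← iteratedDeriv_succ'] at h
  convert h using 1 <;> norm_num [Nat.factorial] <;> ring

lemma Jet.exp (c : ℂ) : Jet (fun a => Complex.exp (c * a)) 1 c (c^2/2) (c^3/6) (c^4/24) := by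
  have h := (Jet.of_analytic (F := Complex.exp) (by fun_prop)).scale c
  simp only [iteratedDeriv_eq_iterate, Complex.iter_deriv_exp, Complex.exp_zero] at h
  convert h using 1 <;> norm_num [Nat.factorial] <;> ring

lemma Jet.limit {F : ℂ → ℂ} {q : ℂ} (hF : Jet F 0 0 0 0 q) :
    Tendsto (fun a => F a / a^4) (𝓝[≠] 0) (𝓝 q) := by
  unfold Jet at hF
  have h0 : (fun a : ℂ => a^5) =o[𝓝 0] (fun a : ℂ => a^4) := Asymptotics.isLittleO_pow_pow (by norm_num)
  have h1 := ((hF.trans_isLittleO h0).mono (nhdsWithin_le_nhds (s := {0}ᶜ))).tendsto_div_nhds_zero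
  have h2 := h1.add_const q
  rw [zero_add] at h2
  refine h2.congr' ?_
  filter_upwards [self_mem_nhdsWithin] with a ha
  have : a ≠ 0 := ha
  field_simp
  ring
/-- numerator on the diagonal -/
noncomputable def Ndiag (f h G : ℂ → ℂ) (x y g1 c1 h0 k : ℂ) (a : ℂ) : ℂ :=
  ((x + c1 + g1)/2) * (a * (f (2*a) * f a * f a * h (2*a)))
  + (1/2) * (f (2*a) * f a * f a * ((2*a) * deriv h (2*a)))
  + (1/4) * (((2*a) * deriv f (2*a) - f (2*a)) * f a * f a * h (2*a))
  + 1 * (f (2*a) * (a * deriv f a - f a) * f a * h (2*a))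
  - (exp ((-2*y)*a) * h ((-2)*a) * f ((-1)*a) * f ((-1)*a) *
      ((1/4) * (((-2)*a) * deriv f ((-2)*a) - f ((-2)*a))
        + ((x-y+g1+c1)/2) * (a * f ((-2)*a))))
  + (2*h0) * (exp ((-y)*a) * f ((-1)*a) * f ((-1)*a) * f a * f a)
  - (h (2*a) * f a * f a *
      ((1/4) * ((2*a) * deriv f (2*a) - f (2*a)) + ((x-y-g1+c1)/2) * (a * f (2*a))))
  + f ((-1)*a) * ((h0*y+k) * (a * (exp ((-x)*a) * G ((-1)*a) * f a))
      + h0 * ((-x) * (a * (exp ((-x)*a) * G ((-1)*a) * f a))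
        + exp ((-x)*a) * (((-1)*a) * deriv G ((-1)*a)) * f a
        + exp ((-x)*a) * G ((-1)*a) * (a * deriv f a)
        - 2 * (exp ((-x)*a) * G ((-1)*a) * f a)))
  - exp ((-x)*a) * G ((-1)*a) * f a * (h0 * (((-1)*a) * deriv f ((-1)*a) - f ((-1)*a))
      - (h0*y+k) * (a * f ((-1)*a)))
  - (1/4) * (exp ((-2*x+2*y)*a) * h (2*a) * G ((-2)*a) * f (2*a) * f a * f a)

set_option maxHeartbeats 4000000 in
lemma Ndiag_jet {f h G : ℂ → ℂ} {x y g1 g2 g3 g4 d0 d1 d2 d3 d4 c1 c2 c3 c4 Q : ℂ}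
    (hf : Jet f 1 g1 g2 g3 g4) (hh : Jet h d0 d1 d2 d3 d4) (hG : Jet G 1 c1 c2 c3 c4)
    (hf' : Jet (fun a => a * deriv f a) 0 g1 (2*g2) (3*g3) (4*g4))
    (hh' : Jet (fun a => a * deriv h a) 0 d1 (2*d2) (3*d3) (4*d4))
    (hG' : Jet (fun a => a * deriv G a) 0 c1 (2*c2) (3*c3) (4*c4))
    (hQ : Q = (16*d4 - 16*d1*g3 + 32*d3*g1 + 32*(g1)^2*d2 - 24*d0*g4 + 8*(g2)^2*d0
       + 5*d0*(g1)^4 + 16*d1*(g1)^3 - 8*d0*g1*g3 + 16*d1*g1*g2 + 12*d0*(g1)^2*g2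
       + 12*(g1)^2*d1*c1 + 12*d0*g1*g2*c1 + 8*d3*c1 + 4*d0*(g1)^3*c1 + 4*d0*g3*c1
       + 8*d1*g2*c1 + 16*g1*d2*c1 - 4*d2*c2 - 6*(g1)^2*d0*c2 - 4*d0*g2*c2
       - 8*g1*d1*c2 + 4*g1*d0*c3 + 2*d1*c3 - d0*c4)
      + ((4*d0*g3 + 12*d0*g1*g2 + 4*d0*(g1)^3 + 8*d1*g2 + 12*d1*(g1)^2 + 16*d2*g1
       + 8*d3 - 4*c1*d0*g2 - 6*c1*d0*(g1)^2 - 8*c1*d1*g1 - 4*c1*d2 + 4*c2*d0*g1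
       + 2*c2*d1 - c3*d0) * x
       + (-12*d0*g3 - 4*d0*g1*g2 - 8*d1*g2 + 4*d1*(g1)^2 + 4*d0*(g1)^3
       + 8*c1*d0*g2 + 12*c1*d0*(g1)^2 + 16*c1*d1*g1 + 8*c1*d2 - 8*c2*d0*g1
       - 4*c2*d1 + 2*c3*d0) * y)
      + ((-2*d0*g2 - 3*d0*(g1)^2 - 4*d1*g1 - 2*d2 + 2*c1*d0*g1 + c1*d1
       - c2*d0/2) * x^2
       + (8*d0*g2 + 12*d0*(g1)^2 + 16*d1*g1 + 8*d2 - 8*c1*d0*g1 - 4*c1*d1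
       + 2*c2*d0) * x*y
       + (-5*d0*(g1)^2 - 4*d2 - 6*d0*g2 - 8*d1*g1 + 8*c1*d0*g1 + 4*c1*d1
       - 2*c2*d0) * y^2)
      + ((2*d0*g1/3 + d1/3 - c1*d0/6) * x^3 + (-4*d0*g1 - 2*d1 + c1*d0) * x^2*y
       + (8*d0*g1 + 4*d1 - 2*c1*d0) * x*y^2 + (-4*d0*g1 - 2*d1 + 4*c1*d0/3) * y^3)
      + (d0/24) * (-x^4 + 8*x^3*y - 24*x^2*y^2 + 32*x*y^3 - 14*y^4)) :
    Jet (Ndiag f h G x y g1 c1 d0 (d1 + d0*g1)) 0 0 0 0 Q := by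
  have f2 := hf.scale 2
  have fm := hf.scale (-1)
  have fm2 := hf.scale (-2)
  have h2 := hh.scale 2
  have hm2 := hh.scale (-2)
  have Gm := hG.scale (-1)
  have Gm2 := hG.scale (-2)
  have df2 := hf'.scale 2
  have dfm := hf'.scale (-1)
  have dfm2 := hf'.scale (-2)
  have dh2 := hh'.scale 2
  have dGm := hG'.scale (-1)
  have e1 := Jet.exp (-2*y)
  have e2 := Jet.exp (-y)
  have e3 := Jet.exp (-x)
  have e4 := Jet.exp (-2*x+2*y)
  have P := (e3.mul Gm).mul hf
  have T1 := (((f2.mul hf).mul hf).mul h2).shift.smul ((x + c1 + g1)/2)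
  have T2 := (((f2.mul hf).mul hf).mul dh2).smul (1/2)
  have T3 := ((((df2.sub f2).mul hf).mul hf).mul h2).smul (1/4)
  have T4 := (((f2.mul (hf'.sub hf)).mul hf).mul h2).smul 1
  have T5 := (((e1.mul hm2).mul fm).mul fm).mul
    (((dfm2.sub fm2).smul (1/4)).add (fm2.shift.smul ((x-y+g1+c1)/2)))
  have T6 := ((((e2.mul fm).mul fm).mul hf).mul hf).smul (2*d0)
  have T7 := ((h2.mul hf).mul hf).mul
    (((df2.sub f2).smul (1/4)).add (f2.shift.smul ((x-y-g1+c1)/2)))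
  have T8 := fm.mul ((P.shift.smul (d0*y+(d1+d0*g1))).add
    (((((P.shift.smul (-x)).add ((e3.mul dGm).mul hf)).add ((e3.mul Gm).mul hf')).sub
      (P.smul 2)).smul d0))
  have T9 := P.mul (((dfm.sub fm).smul d0).sub (fm.shift.smul (d0*y+(d1+d0*g1))))
  have T10 := (((((e4.mul h2).mul Gm2).mul f2).mul hf).mul hf).smul (1/4)
  have T := ((((((((T1.add T2).add T3).add T4).sub T5).add T6).sub T7).add T8).sub T9).sub T10
  rw [hQ]
  convert T using 1
  · rfl
  · ring
  · ring
  · ring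
  · ring
  · ring
/-- regular part -/
noncomputable def Rreg (f h G : ℂ → ℂ) (x y g1 c1 : ℂ) (a b : ℂ) : ℂ :=
  (x + c1 + g1) * (f (a+b)/(a+b)) * (f a / a) * (f b / b) * h (a+b)
  + 2 * (f (a+b)/(a+b)) * (f a / a) * (f b / b) * deriv h (a+b)
  + (deriv f (a+b)/(a+b) - f (a+b)/(a+b)^2) * (f a / a) * (f b / b) * h (a+b)
  + (f (a+b)/(a+b)) * (deriv f a / a - f a / a^2) * (f b / b) * h (a+b)
  + (f (a+b)/(a+b)) * (f a / a) * (deriv f b / b - f b / b^2) * h (a+b)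
  + (-(exp (-y*(a+b)) * h (-(a+b)) * (f (-a)/a) * (f (-b)/b) *
      ((-(a+b) * deriv f (-(a+b)) - f (-(a+b)))/(a+b)^2 + (f (-(a+b))/(a+b)) * (x - y + g1 + c1)))
  + exp (-y*a) * h (b-a) * ((f (-a))^2/a^2) * ((f b)^2/b^2)
  + exp (-y*b) * h (a-b) * ((f (-b))^2/b^2) * ((f a)^2/a^2)
  - h (a+b) * (f a / a) * (f b / b) *
      (((a+b) * deriv f (a+b) - f (a+b))/(a+b)^2 + (f (a+b)/(a+b)) * (x - y - g1 + c1))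
  - exp (-x*(a+b)) * exp (y*(a+b)) * h (a+b) *
      (G (-(a+b))/(a+b)) * (f (a+b)/(a+b)) * (f a / a) * (f b / b))

noncomputable def Uf (f h G : ℂ → ℂ) (x y : ℂ) (a b : ℂ) : ℂ :=
  exp (-x*b) * exp (-y*(a-b)) * h (b-a) * (G (-b)/b) *
      f (b-a) * (f (-a)/a) * (f b / b)
noncomputable def Vf (f h G : ℂ → ℂ) (x y : ℂ) (a b : ℂ) : ℂ :=
  exp (-x*a) * exp (-y*(b-a)) * h (a-b) * (G (-a)/a) *
      f (a-b) * (f a / a) * (f (-b)/b)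

lemma Rreg_cont {f h G : ℂ → ℂ} (x y g1 c1 : ℂ) (hf : Differentiable ℂ f) (hG : Differentiable ℂ G)
    (hh : ∀ s, ‖s‖ < 1 → AnalyticAt ℂ h s) {a : ℂ} (ha : a ≠ 0) (ha1 : ‖a‖ < 1/2) :
    ContinuousAt (Rreg f h G x y g1 c1 a) a := by
  have hfc := hf.continuous
  have hGc := hG.continuous
  have hf' : Continuous (deriv f) := by
    have : ContDiff ℂ 1 f := hf.contDiff
    exact this.continuous_deriv (le_refl _)
  have n2 : ‖a + a‖ < 1 := by linarith [norm_add_le a a]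
  have hh2 := hh _ n2
  have hhm := hh (-(a+a)) (by rwa [norm_neg])
  have hh0 := hh 0 (by simp)
  have k1 : ContinuousAt h (a+a) := hh2.continuousAt
  have k2 : ContinuousAt (deriv h) (a+a) := hh2.deriv.continuousAt
  have k3 : ContinuousAt h (-(a+a)) := hhm.continuousAt
  have k4 : ContinuousAt h (a-a) := by rw [sub_self]; exact hh0.continuousAt
  have d1 : a + a ≠ 0 := by rw [← two_mul]; simpa using ha
  have d2 : (a + a)^2 ≠ 0 := pow_ne_zero _ d1
  have d3 : a^2 ≠ 0 := pow_ne_zero _ ha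
  unfold Rreg
  clear hh2 hhm hh0 hf hG hh
  generalize deriv h = h' at *
  generalize deriv f = f' at *
  fun_prop (disch := assumption)

lemma U_deriv {f h G : ℂ → ℂ} (x y : ℂ) (hf : Differentiable ℂ f) (hG : Differentiable ℂ G)
    (hf0 : f 0 = 1) (hh : AnalyticAt ℂ h 0) {a : ℂ} (ha : a ≠ 0) :
    HasDerivAt (Uf f h G x y a)
     ((f ((-1)*a) * ((h 0*y+(deriv h 0 + h 0 * deriv f 0)) * (a * (exp ((-x)*a) * G ((-1)*a) * f a))
      + h 0 * ((-x) * (a * (exp ((-x)*a) * G ((-1)*a) * f a))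
        + exp ((-x)*a) * (((-1)*a) * deriv G ((-1)*a)) * f a
        + exp ((-x)*a) * G ((-1)*a) * (a * deriv f a)
        - 2 * (exp ((-x)*a) * G ((-1)*a) * f a))))/a^4) a := by
  have i1 : HasDerivAt (fun b : ℂ => -x*b) (-x) a := by simpa using (hasDerivAt_id a).const_mul (-x)
  have i2 : HasDerivAt (fun b : ℂ => -y*(a-b)) y a := by
    simpa using ((hasDerivAt_id a).const_sub a).const_mul (-y)
  have i3 : HasDerivAt (fun b : ℂ => b - a) 1 a := (hasDerivAt_id a).sub_const a
  have i4 : HasDerivAt (fun b : ℂ => -b) (-1) a := (hasDerivAt_id a).neg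
  have e1 := i1.cexp
  have e2 := i2.cexp
  have e3 : HasDerivAt (fun b => h (b-a)) (deriv h 0 * 1) a := by
    refine HasDerivAt.comp (h₂ := h) a ?_ i3
    rw [sub_self]; exact hh.differentiableAt.hasDerivAt
  have e4 : HasDerivAt (fun b => G (-b)) (deriv G (-a) * (-1)) a :=
    HasDerivAt.comp (h₂ := G) a (hG (-a)).hasDerivAt i4
  have e5 : HasDerivAt (fun b => f (b-a)) (deriv f 0 * 1) a := by
    refine HasDerivAt.comp (h₂ := f) a ?_ i3
    rw [sub_self]; exact (hf 0).hasDerivAt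
  have e6 := (hf a).hasDerivAt
  have key := (((((e1.mul e2).mul e3).mul (e4.div (hasDerivAt_id a) ha)).mul e5).mul
    (hasDerivAt_const a (f (-a)/a))).mul (e6.div (hasDerivAt_id a) ha)
  refine HasDerivAt.congr_deriv (f := Uf f h G x y a) key ?_
  simp only [Pi.mul_apply, Pi.div_apply, id, sub_self, mul_zero, Complex.exp_zero, hf0, neg_one_mul]
  field_simp
  ring

lemma V_deriv {f h G : ℂ → ℂ} (x y : ℂ) (hf : Differentiable ℂ f)
    (hf0 : f 0 = 1) (hh : AnalyticAt ℂ h 0) {a : ℂ} (ha : a ≠ 0) :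
    HasDerivAt (Vf f h G x y a)
     ((exp ((-x)*a) * G ((-1)*a) * f a * (h 0 * (((-1)*a) * deriv f ((-1)*a) - f ((-1)*a))
      - (h 0*y+(deriv h 0 + h 0 * deriv f 0)) * (a * f ((-1)*a))))/a^4) a := by
  have i2 : HasDerivAt (fun b : ℂ => -y*(b-a)) (-y) a := by
    simpa using ((hasDerivAt_id a).sub_const a).const_mul (-y)
  have i3 : HasDerivAt (fun b : ℂ => a - b) (-1) a := (hasDerivAt_id a).const_sub a
  have i4 : HasDerivAt (fun b : ℂ => -b) (-1) a := (hasDerivAt_id a).neg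
  have e2 := i2.cexp
  have e3 : HasDerivAt (fun b => h (a-b)) (deriv h 0 * (-1)) a := by
    refine HasDerivAt.comp (h₂ := h) a ?_ i3
    rw [sub_self]; exact hh.differentiableAt.hasDerivAt
  have e4 : HasDerivAt (fun b => f (-b)) (deriv f (-a) * (-1)) a :=
    HasDerivAt.comp (h₂ := f) a (hf (-a)).hasDerivAt i4
  have e5 : HasDerivAt (fun b => f (a-b)) (deriv f 0 * (-1)) a := by
    refine HasDerivAt.comp (h₂ := f) a ?_ i3
    rw [sub_self]; exact (hf 0).hasDerivAt
  have key := ((((((hasDerivAt_const a (exp (-x*a))).mul e2).mul e3).mul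
    (hasDerivAt_const a (G (-a)/a))).mul e5).mul
    (hasDerivAt_const a (f a/a))).mul (e4.div (hasDerivAt_id a) ha)
  refine HasDerivAt.congr_deriv (f := Vf f h G x y a) key ?_
  simp only [Pi.mul_apply, Pi.div_apply, id, sub_self, mul_zero, Complex.exp_zero, hf0, neg_one_mul]
  field_simp
  ring

lemma UV_tendsto {f h G : ℂ → ℂ} (x y g1 c1 : ℂ) (hf : Differentiable ℂ f) (hG : Differentiable ℂ G)
    (hf0 : f 0 = 1) (hh : ∀ s, ‖s‖ < 1 → AnalyticAt ℂ h s) {a : ℂ} (ha : a ≠ 0) (ha1 : ‖a‖ < 1/2) :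
    Tendsto (fun b => Rreg f h G x y g1 c1 a b + (Uf f h G x y a b - Vf f h G x y a b) / (b - a))
      (𝓝[≠] a) (𝓝 (Ndiag f h G x y g1 c1 (h 0) (deriv h 0 + h 0 * deriv f 0) a / a^4)) := by
  have hU := U_deriv (G := G) x y hf hG hf0 (hh 0 (by simp)) ha
  have hV := V_deriv (G := G) x y hf hf0 (hh 0 (by simp)) ha
  have hUV := hasDerivAt_iff_tendsto_slope.1 (hU.sub hV)
  have h1 := (Rreg_cont x y g1 c1 hf hG hh ha ha1).tendsto.mono_left (nhdsWithin_le_nhds (s := {a}ᶜ))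
  have h2 := h1.add hUV
  have h3 : Uf f h G x y a a = Vf f h G x y a a := by
    simp only [Uf, Vf, sub_self, hf0]; ring
  have e2 : exp ((-2*y)*a) = exp (-y*(a+a)) := by congr 1; ring
  have e3 : exp ((-2*x+2*y)*a) = exp (-x*(a+a)) * exp (y*(a+a)) := by
    rw [← Complex.exp_add]; congr 1; ring
  have h4 := h2.congr' (f₂ := fun b => Rreg f h G x y g1 c1 a b
    + (Uf f h G x y a b - Vf f h G x y a b) / (b - a)) ?_
  · convert h4 using 2
    have z1 : a + a = 2 * a := by ring
    have z2 : (-2 : ℂ) * a = -(2 * a) := by ring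
    simp only [Rreg, Ndiag, e2, e3, z1, z2, neg_one_mul, sub_self]
    field_simp
    ring
  · filter_upwards with b
    simp only [slope_def_field, Pi.sub_apply, h3, sub_self, sub_zero]
lemma fzeta_eq : fzeta = fun s => riemannZeta₁ (1 + s) := by
  funext s
  unfold fzeta
  split_ifs with h
  · simp [h]
  · have h1 : (1 + s) ≠ 1 := by simpa using h
    rw [riemannZeta_eq_inv_sub_mul h1]
    have : (1 + s - 1) = s := by ring
    rw [this]
    field_simp

lemma fzeta_diff : Differentiable ℂ fzeta := by
  rw [fzeta_eq]; fun_prop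

lemma fzeta_zero : fzeta 0 = 1 := by simp [fzeta]

lemma fzeta_deriv_zero : deriv fzeta 0 = eulerγ := by
  rw [fzeta_eq, deriv_comp_const_add, add_zero, deriv_riemannZeta₁_one, eulerγ]

lemma two_add_re {s : ℂ} (hs : ‖s‖ < 1) : 1 < (2 + s).re := by
  have := (abs_le.1 (Complex.abs_re_le_norm s)).1
  simp only [Complex.add_re, Complex.re_ofNat]
  linarith

lemma hzeta_hasDeriv {s : ℂ} (hs : ‖s‖ < 1) : HasDerivAt hzeta (Hfun s) s := by
  have hre := two_add_re hs
  have hne : riemannZeta (2 + s) ≠ 0 := riemannZeta_ne_zero_of_one_lt_re hre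
  have h1 : 2 + s ≠ 1 := by
    intro h; rw [h] at hre; simp at hre
  have hd := (differentiableAt_riemannZeta h1).hasDerivAt
  have hc : HasDerivAt (fun s => riemannZeta (2 + s)) (deriv riemannZeta (2 + s)) s :=
    hd.comp_const_add 2 s
  exact hc.inv hne

lemma hzeta_analytic (s : ℂ) (hs : ‖s‖ < 1) : AnalyticAt ℂ hzeta s := by
  have hd : DifferentiableOn ℂ hzeta (Metric.ball 0 1) := fun z hz =>
    (hzeta_hasDeriv (by simpa using hz)).differentiableAt.differentiableWithinAt
  exact hd.analyticAt (Metric.isOpen_ball.mem_nhds (by simpa using hs))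

lemma Ffun_eq {s : ℂ} (hs : s ≠ 0) : Ffun s = s * deriv fzeta s - fzeta s := by
  have h1 : 1 + s ≠ 1 := by simpa using hs
  have hd : HasDerivAt (fun s => riemannZeta (1 + s)) (deriv riemannZeta (1 + s)) s :=
    (differentiableAt_riemannZeta h1).hasDerivAt.comp_const_add 1 s
  have h2 : HasDerivAt (fun s => s * riemannZeta (1 + s))
      (1 * riemannZeta (1 + s) + s * deriv riemannZeta (1 + s)) s := (hasDerivAt_id s).mul hd
  have h3 : fzeta =ᶠ[𝓝 s] fun s => s * riemannZeta (1 + s) := by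
    filter_upwards [isOpen_ne.mem_nhds hs] with z hz
    simp [fzeta, show z ≠ 0 from hz]
  rw [h3.deriv_eq, h2.deriv]
  simp only [fzeta, hs, if_false, Ffun]
  ring

lemma Gfun_zero {μ : ℝ} (hμ0 : 0 < μ) {φ : ℝ → ℝ} (hφ : SmoothingFn μ φ) : Gfun φ 0 = 1 := by
  have hs := hφ.smooth
  have hdiff : Differentiable ℝ φ := hs.differentiable (by simp)
  have hcd : Continuous (deriv φ) := hs.continuous_deriv (by simp)
  have hz : ∀ t, 1 + μ < t → φ t * deriv φ t = 0 := by
    intro t ht; rw [hφ.eq_zero t ht.le, zero_mul]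
  have hcont : Continuous (fun t => φ t * deriv φ t) := hdiff.continuous.mul hcd
  have hint : IntegrableOn (fun t => φ t * deriv φ t) (Set.Ioi 0) := by
    have h1 : IntegrableOn (fun t => φ t * deriv φ t) (Set.Icc 0 (1+μ)) :=
      hcont.continuousOn.integrableOn_compact isCompact_Icc
    refine IntegrableOn.of_forall_sdiff_eq_zero h1 measurableSet_Ioi ?_
    rintro t ⟨ht, ht'⟩
    apply hz
    by_contra hc
    exact ht' ⟨le_of_lt ht, not_lt.1 hc⟩
  have hFTC := integral_Ioi_of_hasDerivAt_of_tendsto (a := 0) (m := 0) (f := fun t => φ t ^ 2 / 2)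
    (f' := fun t => φ t * deriv φ t)
    (by have := hdiff.continuous; fun_prop)
    (fun t _ => by
      have := ((hdiff t).hasDerivAt.pow 2).div_const 2
      refine this.congr_deriv ?_
      simp; ring)
    hint
    (by
      refine tendsto_const_nhds.congr' ?_
      filter_upwards [eventually_ge_atTop (1+μ)] with t ht
      simp [hφ.eq_zero t ht])
  unfold Gfun
  simp only [Complex.cpow_zero, mul_one]
  rw [integral_complex_ofReal, hFTC, hφ.eq_one 0 le_rfl zero_le_one]
  norm_num

lemma Gfun_diff {μ : ℝ} {φ : ℝ → ℝ} (hφ : SmoothingFn μ φ) :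
    Differentiable ℂ (Gfun φ) := by
  have hs := hφ.smooth
  have hdiff : Differentiable ℝ φ := hs.differentiable (by simp)
  have hcd : Continuous (deriv φ) := hs.continuous_deriv (by simp)
  have hcont : Continuous (fun t => ((φ t * deriv φ t : ℝ) : ℂ)) := by
    have := hdiff.continuous; fun_prop
  have heq : Gfun φ = fun s => -2 * mellin (fun t => ((φ t * deriv φ t : ℝ) : ℂ)) (s + 1) := by
    funext s
    simp only [Gfun, mellin, smul_eq_mul, add_sub_cancel_right]
    congr 2
    funext t
    ring
  have hm : Differentiable ℂ (mellin (fun t => ((φ t * deriv φ t : ℝ) : ℂ))) := by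
    intro s
    refine mellin_differentiableAt_of_isBigO_rpow (a := s.re + 1) (b := s.re - 1)
      (hcont.continuousOn.locallyIntegrableOn measurableSet_Ioi) ?_ (by linarith) ?_ (by linarith)
    · refine Asymptotics.IsBigO.congr' (Asymptotics.isBigO_zero _ _) ?_ EventuallyEq.rfl
      filter_upwards [eventually_ge_atTop (1+μ)] with t ht
      simp [hφ.eq_zero t ht]
    · refine Asymptotics.IsBigO.congr' (Asymptotics.isBigO_zero _ _) ?_ EventuallyEq.rfl
      filter_upwards [Ioo_mem_nhdsGT (zero_lt_one' ℝ)] with t ht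
      have : φ =ᶠ[𝓝 t] fun _ => 1 := by
        filter_upwards [Ioo_mem_nhds ht.1 ht.2] with u hu
        exact hφ.eq_one u hu.1.le hu.2.le
      simp [this.deriv_eq]
  rw [heq]
  exact (hm.comp (differentiable_id.add_const 1)).const_mul _

lemma cpow_exp {r : ℝ} (hr : 0 < r) (s : ℂ) : ((r : ℝ) : ℂ) ^ s = Complex.exp ((Real.log r : ℂ) * s) := by
  rw [Complex.cpow_def_of_ne_zero (by exact_mod_cast hr.ne'), Complex.ofReal_log hr.le]

/-- the iterated limit `lim_{a→0} lim_{b→a} R(a,b)` exists and equals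
`Σ_{j=0}^{4} Q_j(log K, log(t/2π))`. -/
theorem statement10
    (μ : ℝ) (hμ0 : 0 < μ) (hμ1 : μ < 1/2) (φ : ℝ → ℝ) (hφ : SmoothingFn μ φ)
    (K : ℝ) (hK : 1 < K) (t : ℝ) (ht : 2*Real.pi < t) :
    ∃ Rdiag : ℂ → ℂ,
      (∀ᶠ a in 𝓝[≠] (0:ℂ),
        Filter.Tendsto (fun b : ℂ => R1 φ K a b + R2 φ K a b t) (𝓝[≠] a) (𝓝 (Rdiag a))) ∧
      Filter.Tendsto Rdiag (𝓝[≠] (0:ℂ))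
        (𝓝 (∑ j ∈ Finset.range 5, Qpoly φ j (Real.log K) (Real.log (t/(2*Real.pi))))) := by
  set x : ℂ := (Real.log K : ℂ) with hx
  set y : ℂ := (Real.log (t/(2*Real.pi)) : ℂ) with hy
  have hpi := Real.pi_pos
  have ht0 : 0 < t := by linarith
  have hK0 : 0 < K := by linarith
  have hc0 : ccoef φ 0 = 1 := by simp [ccoef, Gfun_zero hμ0 hφ]
  have hg0 : gcoef 0 = 1 := by simp [gcoef, fzeta_zero]
  have hg1 : gcoef 1 = eulerγ := by simp [gcoef, fzeta_deriv_zero]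
  have hd0 : dcoef 0 = hzeta 0 := by simp [dcoef]
  have hd1 : dcoef 1 = deriv hzeta 0 := by simp [dcoef]
  have han := hzeta_analytic 0 (by simp)
  have jf := Jet.of_analytic (fzeta_diff.analyticAt 0)
  have jf' := Jet.of_deriv (fzeta_diff.analyticAt 0)
  have jG := Jet.of_analytic ((Gfun_diff hφ).analyticAt 0)
  have jG' := Jet.of_deriv ((Gfun_diff hφ).analyticAt 0)
  have jh := Jet.of_analytic han
  have jh' := Jet.of_deriv han
  change Jet _ (gcoef 0) (gcoef 1) (gcoef 2) (gcoef 3) (gcoef 4) at jf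
  change Jet _ 0 (gcoef 1) (2 * gcoef 2) (3 * gcoef 3) (4 * gcoef 4) at jf'
  change Jet _ (ccoef φ 0) (ccoef φ 1) (ccoef φ 2) (ccoef φ 3) (ccoef φ 4) at jG
  change Jet _ 0 (ccoef φ 1) (2 * ccoef φ 2) (3 * ccoef φ 3) (4 * ccoef φ 4) at jG'
  change Jet _ (dcoef 0) (dcoef 1) (dcoef 2) (dcoef 3) (dcoef 4) at jh
  change Jet _ 0 (dcoef 1) (2 * dcoef 2) (3 * dcoef 3) (4 * dcoef 4) at jh'
  rw [hg0] at jf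
  rw [hc0] at jG
  refine ⟨fun a => Ndiag fzeta hzeta (Gfun φ) x y (gcoef 1) (ccoef φ 1) (dcoef 0)
    (dcoef 1 + dcoef 0 * gcoef 1) a / a^4, ?_, ?_⟩
  · have hb : ∀ᶠ a : ℂ in 𝓝[≠] 0, ‖a‖ < 1/2 := by
      refine Filter.Eventually.filter_mono nhdsWithin_le_nhds ?_
      filter_upwards [Metric.ball_mem_nhds (0:ℂ) (show (0:ℝ) < 1/2 by norm_num)] with a ha
      simpa using ha
    filter_upwards [hb, self_mem_nhdsWithin] with a ha1 ha
    have ha0 : a ≠ 0 := ha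
    have hT := UV_tendsto (G := Gfun φ) x y (gcoef 1) (ccoef φ 1) fzeta_diff (Gfun_diff hφ)
      fzeta_zero hzeta_analytic ha0 ha1
    rw [← hd0, ← hd1, fzeta_deriv_zero, ← hg1] at hT
    refine hT.congr' ?_
    have hab : ∀ᶠ b : ℂ in 𝓝[≠] a, ‖b‖ < 1/2 ∧ a + b ≠ 0 := by
      refine Filter.Eventually.filter_mono nhdsWithin_le_nhds ?_
      have c1 : ContinuousAt (fun b : ℂ => a + b) a := by fun_prop
      have c2 : a + a ≠ 0 := by rw [← two_mul]; simpa using ha0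
      exact (continuous_norm.continuousAt.eventually_lt continuousAt_const ha1).and
        (c1.eventually_ne c2)
    filter_upwards [hab, self_mem_nhdsWithin] with b hb hba
    obtain ⟨hb1, hb2⟩ := hb
    have hba' : b ≠ a := hba
    have s1 : b - a ≠ 0 := sub_ne_zero.2 hba'
    have hn : ‖a + b‖ < 1 := by linarith [norm_add_le a b]
    have hH : Hfun (a+b) = deriv hzeta (a+b) := (hzeta_hasDeriv hn).deriv.symm
    have hw : (0:ℝ) < 2*Real.pi/t := by positivity
    have hlw : Real.log (2*Real.pi/t) = - Real.log (t/(2*Real.pi)) := by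
      rw [← Real.log_inv, inv_div]
    have hlX : Real.log (2 * Real.pi * K / t) = Real.log K - Real.log (t/(2*Real.pi)) := by
      rw [← Real.log_div hK0.ne' (by positivity)]
      congr 1
      field_simp
    have hwp : ∀ s : ℂ, ((2*Real.pi/t : ℝ) : ℂ)^s = Complex.exp (-y * s) := by
      intro s
      rw [cpow_exp hw, hlw, hy]; push_cast; rfl
    have hKp : ∀ s : ℂ, ((K : ℝ) : ℂ)^s = Complex.exp (x * s) := fun s => cpow_exp hK0 s
    have hKn : ∀ s : ℂ, ((K : ℝ) : ℂ)^(-s) = Complex.exp (-x * s) := by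
      intro s; rw [hKp]; congr 1; ring
    have hwn : ((2*Real.pi/t : ℝ) : ℂ)^(-(a+b)) = Complex.exp (y * (a+b)) := by
      rw [hwp]; congr 1; ring
    have hX : (Real.log (2 * Real.pi * K / t) : ℂ) = x - y := by
      rw [hlX]; push_cast; rfl
    have hdiv : fzeta (a-b)/(a-b) = - (fzeta (a-b)/(b-a)) := by
      rw [← neg_sub b a, div_neg]
    simp only [R1, R2]
    rw [hX, hH, hwn, hKn, hKn, hKn, Ffun_eq hb2, Ffun_eq (neg_ne_zero.2 hb2), ← hg1, hdiv]
    simp only [hwp]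
    rw [← hx]
    simp only [Rreg, Uf, Vf]
    ring
  · refine Jet.limit (Ndiag_jet jf jh jG jf' jh' jG' ?_)
    have hz : (1/(24 * riemannZeta 2)) = dcoef 0 / 24 := by
      rw [hd0, hzeta, add_zero]; field_simp
    simp only [Finset.sum_range_succ, Finset.sum_range_zero, Qpoly, hz, zero_add]
    rfl

end CHN
end
end

section
/- Let I = {a₁,...,a_k} and J = {b₁,...,b_ℓ} be multisets of complex numbers with Re a_i > 0 and Re b_j > 0 for all i, j. Then the series Σ_{n=1}^∞ σ_I(n)σ_J(n)/n converges absolutely, the Euler product A(I,J) = Π_p [Π_{i=1}^k Π_{j=1}^ℓ (1 − p^{−1−a_i−b_j}) · Σ_{u=0}^∞ σ_I(p^u)σ_J(p^u) p^{−u}] converges absolutely, and Σ_{n=1}^∞ σ_I(n)σ_J(n)/n = A(I,J) · Π_{i=1}^k Π_{j=1}^ℓ ζ(1 + a_i + b_j). -/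
open Complex MeasureTheory Filter Finset Set
open scoped Real Topology BigOperators

noncomputable section

namespace CHN

/-- The arithmetic function `n ↦ n ^ (-s)`. -/
def powAF (s : ℂ) : ArithmeticFunction ℂ :=
  ⟨fun n => if n = 0 then 0 else (n : ℂ) ^ (-s), by simp⟩

lemma powAF_apply (s : ℂ) {n : ℕ} (hn : n ≠ 0) : powAF s n = (n : ℂ) ^ (-s) := by
  simp [powAF, hn]

lemma powAF_mult (s : ℂ) : (powAF s).IsMultiplicative := by
  rw [ArithmeticFunction.IsMultiplicative.iff_ne_zero]
  refine ⟨by simp [powAF], ?_⟩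
  intro m n hm hn _
  rw [powAF_apply s (mul_ne_zero hm hn), powAF_apply s hm, powAF_apply s hn]
  push_cast
  exact Complex.natCast_mul_natCast_cpow m n (-s)

lemma sigmaShift_eq_antidiag {k : ℕ} (a : Fin k → ℂ) {n : ℕ} (hn : n ≠ 0) :
    sigmaShift a n = ∑ d ∈ Nat.finMulAntidiag k n, ∏ i, ((d i : ℕ) : ℂ) ^ (-a i) := by
  unfold sigmaShift
  rw [← Finset.sum_filter]
  refine Finset.sum_bij (fun d _ => fun i => (d i : ℕ)) ?_ ?_ ?_ ?_
  · intro d hd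
    rw [Nat.mem_finMulAntidiag]
    exact ⟨(Finset.mem_filter.mp hd).2, hn⟩
  · intro d _ e _ h
    funext i
    exact Fin.ext (congrFun h i)
  · intro d hd
    have h1 := Nat.dvd_of_mem_finMulAntidiag hd
    refine ⟨fun i => ⟨d i, Nat.lt_succ_of_le (Nat.le_of_dvd (Nat.pos_of_ne_zero hn) (h1 i))⟩, ?_, rfl⟩
    simpa using (Nat.mem_finMulAntidiag.mp hd).1
  · intro d _
    rfl

lemma sigmaShift_succ {k : ℕ} (a : Fin (k+1) → ℂ) {n : ℕ} (hn : n ≠ 0) :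
    sigmaShift a n = ∑ x ∈ n.divisorsAntidiagonal,
      (x.1 : ℂ) ^ (-a 0) * sigmaShift (fun i => a i.succ) x.2 := by
  have h : ∀ x ∈ n.divisorsAntidiagonal,
      (x.1 : ℂ) ^ (-a 0) * sigmaShift (fun i => a i.succ) x.2
      = ∑ d ∈ Nat.finMulAntidiag k x.2, (x.1 : ℂ) ^ (-a 0) * ∏ i, ((d i : ℕ) : ℂ) ^ (-a i.succ) := by
    intro x hx
    have hx' := Nat.mem_divisorsAntidiagonal.mp hx
    have : x.2 ≠ 0 := by
      rintro h0
      rw [h0] at hx'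
      simp at hx'
      omega
    rw [sigmaShift_eq_antidiag _ this, Finset.mul_sum]
  rw [Finset.sum_congr rfl h, Finset.sum_sigma', sigmaShift_eq_antidiag _ hn]
  refine Finset.sum_bij' (fun d _ => ⟨(d 0, ∏ i : Fin k, d i.succ), fun i => d i.succ⟩)
    (fun y _ => Fin.cons y.1.1 y.2) ?_ ?_ ?_ ?_ ?_
  · intro d hd
    have h1 := Nat.mem_finMulAntidiag.mp hd
    rw [Fin.prod_univ_succ] at h1
    have h2 : ∏ i : Fin k, d i.succ ≠ 0 := fun h0 => hn (by rw [← h1.1, h0, mul_zero])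
    simp only [Finset.mem_sigma, Nat.mem_divisorsAntidiagonal, Nat.mem_finMulAntidiag]
    exact ⟨h1, trivial, h2⟩
  · intro y hy
    simp only [Finset.mem_sigma, Nat.mem_divisorsAntidiagonal, Nat.mem_finMulAntidiag] at hy
    rw [Nat.mem_finMulAntidiag, Fin.prod_univ_succ]
    simp only [Fin.cons_zero, Fin.cons_succ]
    exact ⟨by rw [hy.2.1]; exact hy.1.1, hn⟩
  · intro d _
    exact Fin.cons_self_tail d
  · rintro ⟨⟨x, y⟩, d⟩ hy
    simp only [Finset.mem_sigma, Nat.mem_divisorsAntidiagonal, Nat.mem_finMulAntidiag] at hy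
    simp [hy.2.1]
  · intro d _
    simp [Fin.prod_univ_succ]

lemma snd_ne_zero_of_mem {n : ℕ} {x : ℕ × ℕ} (hx : x ∈ n.divisorsAntidiagonal) :
    x.1 ≠ 0 ∧ x.2 ≠ 0 := by
  have hx' := Nat.mem_divisorsAntidiagonal.mp hx
  rw [← hx'.1] at hx'
  exact mul_ne_zero_iff.mp hx'.2

lemma sigmaShift_eq_prod {k : ℕ} (a : Fin k → ℂ) : ∀ {n : ℕ}, n ≠ 0 →
    sigmaShift a n = (∏ i, powAF (a i)) n := by
  induction k with
  | zero =>
    intro n hn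
    by_cases h : n = 1
    · subst h
      simp [sigmaShift]
    · simp [sigmaShift, ArithmeticFunction.one_apply_ne h, Ne.symm h]
  | succ k ih =>
    intro n hn
    rw [sigmaShift_succ a hn, Fin.prod_univ_succ, ArithmeticFunction.mul_apply]
    refine Finset.sum_congr rfl fun x hx => ?_
    obtain ⟨h1, h2⟩ := snd_ne_zero_of_mem hx
    rw [powAF_apply _ h1, ih (fun i => a i.succ) h2]

lemma sigmaShift_one {k : ℕ} (a : Fin k → ℂ) : sigmaShift a 1 = 1 := by
  rw [sigmaShift_eq_prod a one_ne_zero]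
  exact (ArithmeticFunction.isMultiplicative_finsetProd _ _ (fun i _ => powAF_mult (a i))).1

lemma sigmaShift_mul {k : ℕ} (a : Fin k → ℂ) {m n : ℕ} (hm : m ≠ 0) (hn : n ≠ 0)
    (h : Nat.Coprime m n) : sigmaShift a (m * n) = sigmaShift a m * sigmaShift a n := by
  rw [sigmaShift_eq_prod a hm, sigmaShift_eq_prod a hn, sigmaShift_eq_prod a (mul_ne_zero hm hn)]
  exact (ArithmeticFunction.isMultiplicative_finsetProd _ _ (fun i _ => powAF_mult (a i))).2 h

/-- The divisor bound. -/
lemma card_divisors_bound {ε : ℝ} (hε : 0 < ε) :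
    ∃ C : ℝ, 0 < C ∧ ∀ n : ℕ, n ≠ 0 → (n.divisors.card : ℝ) ≤ C * (n : ℝ) ^ ε := by
  obtain ⟨N, hN⟩ := exists_nat_ge ((2:ℝ) ^ (1/ε))
  have hl : 0 < Real.log 2 := Real.log_pos (by norm_num)
  set K : ℝ := 1 + 1 / (ε * Real.log 2) with hK
  have hK1 : 1 ≤ K := by
    have : 0 < 1 / (ε * Real.log 2) := by positivity
    linarith
  have small : ∀ p v : ℕ, 2 ≤ p → ((v:ℝ) + 1) ≤ K * ((p:ℝ) ^ v) ^ ε := by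
    intro p v hp
    have hp' : (2:ℝ) ≤ p := by exact_mod_cast hp
    have h1 : ((2:ℝ) ^ v) ^ ε ≤ ((p:ℝ) ^ v) ^ ε := by gcongr
    have h2 : 1 + v * (ε * Real.log 2) ≤ ((2:ℝ) ^ v) ^ ε := by
      rw [Real.rpow_def_of_pos (by positivity), Real.log_pow]
      have := Real.add_one_le_exp ((v:ℝ) * Real.log 2 * ε)
      linarith
    have h3 : (v:ℝ) + 1 ≤ K * (1 + v * (ε * Real.log 2)) := by
      have h5 : 0 < ε * Real.log 2 := by positivity
      have h4 : K * (1 + v * (ε * Real.log 2))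
          = 1 + v * (ε * Real.log 2) + 1 / (ε * Real.log 2) + v := by
        rw [hK]; field_simp; ring
      have h6 : (0:ℝ) ≤ v * (ε * Real.log 2) := by positivity
      have h7 : 0 < 1 / (ε * Real.log 2) := by positivity
      linarith
    refine h3.trans ?_
    have : (0:ℝ) ≤ K := by linarith
    exact mul_le_mul_of_nonneg_left (h2.trans h1) this
  have large : ∀ p v : ℕ, N ≤ p → ((v:ℝ) + 1) ≤ ((p:ℝ) ^ v) ^ ε := by
    intro p v hp
    have hp' : (N:ℝ) ≤ p := by exact_mod_cast hp
    have h1 : (2:ℝ) ≤ (p:ℝ) ^ ε := by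
      have : ((2:ℝ) ^ (1/ε)) ^ ε ≤ (p:ℝ) ^ ε := by
        gcongr
        exact hN.trans hp'
      rwa [← Real.rpow_mul (by norm_num), one_div_mul_cancel hε.ne', Real.rpow_one] at this
    have h2 : ((p:ℝ) ^ v) ^ ε = ((p:ℝ) ^ ε) ^ v := by
      rw [← Real.rpow_natCast, ← Real.rpow_natCast, ← Real.rpow_mul (by positivity),
        ← Real.rpow_mul (by positivity), mul_comm]
    rw [h2]
    have h3 : (v:ℝ) + 1 ≤ 2 ^ v := by exact_mod_cast Nat.lt_two_pow_self (n := v)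
    refine h3.trans (by gcongr)
  refine ⟨K ^ N, by positivity, fun n hn => ?_⟩
  rw [Nat.card_divisors hn]
  push_cast
  have hprod : (n:ℝ) ^ ε = ∏ p ∈ n.primeFactors, (((p:ℝ) ^ (n.factorization p)) ^ ε) := by
    rw [Real.finsetProd_rpow _ _ (fun i _ => by positivity)]
    congr 1
    conv_lhs => rw [← Nat.prod_factorization_pow_eq_self hn]
    rw [Finsupp.prod, Nat.support_factorization]
    push_cast
    rfl
  rw [hprod]
  calc ∏ p ∈ n.primeFactors, ((n.factorization p : ℝ) + 1)
      ≤ ∏ p ∈ n.primeFactors, ((if p < N then K else 1) *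
          (((p:ℝ) ^ (n.factorization p)) ^ ε)) := by
        refine Finset.prod_le_prod (fun i _ => by positivity) fun p hp => ?_
        split_ifs with h
        · exact small p _ (Nat.prime_of_mem_primeFactors hp).two_le
        · rw [one_mul]; exact large p _ (not_lt.mp h)
    _ = (∏ p ∈ n.primeFactors, (if p < N then K else 1)) *
          ∏ p ∈ n.primeFactors, (((p:ℝ) ^ (n.factorization p)) ^ ε) := Finset.prod_mul_distrib
    _ ≤ _ := by
        refine mul_le_mul_of_nonneg_right ?_ (Finset.prod_nonneg fun i _ => by positivity)
        rw [← Finset.prod_filter, Finset.prod_const]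
        refine pow_le_pow_right₀ hK1 ?_
        calc _ ≤ (Finset.range N).card := Finset.card_le_card (by
                intro p hp
                exact Finset.mem_range.mpr (Finset.mem_filter.mp hp).2)
          _ = N := Finset.card_range N

lemma sigmaShift_bound {k : ℕ} (a : Fin k → ℂ) : ∀ δ : ℝ, (∀ i, δ < (a i).re) →
    ∃ C : ℝ, 0 < C ∧ ∀ n : ℕ, n ≠ 0 → ‖sigmaShift a n‖ ≤ C * (n : ℝ) ^ (-δ) := by
  induction k with
  | zero =>
    intro δ _
    refine ⟨1, one_pos, fun n hn => ?_⟩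
    rw [sigmaShift_eq_prod a hn]
    by_cases h : n = 1
    · subst h; simp
    · simp [ArithmeticFunction.one_apply_ne h]
      positivity
  | succ k ih =>
    intro δ hδ
    obtain ⟨δ', h1, h2⟩ : ∃ δ' : ℝ, δ < δ' ∧ ∀ i, δ' < (a i).re := by
      have hne : (Finset.univ : Finset (Fin (k+1))).Nonempty := Finset.univ_nonempty
      obtain ⟨i₀, _, hi₀⟩ := Finset.exists_min_image Finset.univ (fun i => (a i).re) hne
      obtain ⟨δ', h1, h2⟩ := exists_between (hδ i₀)
      exact ⟨δ', h1, fun i => h2.trans_le (hi₀ i (Finset.mem_univ _))⟩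
    obtain ⟨C, hC, hb⟩ := ih (fun i => a i.succ) δ' (fun i => h2 _)
    obtain ⟨D, hD, hd⟩ := card_divisors_bound (sub_pos.mpr h1)
    refine ⟨C * D, by positivity, fun n hn => ?_⟩
    rw [sigmaShift_succ a hn]
    have hn' : (0:ℝ) < n := by exact_mod_cast Nat.pos_of_ne_zero hn
    calc _ ≤ ∑ x ∈ n.divisorsAntidiagonal, ‖(x.1 : ℂ) ^ (-a 0) * sigmaShift (fun i => a i.succ) x.2‖ :=
          norm_sum_le _ _
      _ ≤ ∑ x ∈ n.divisorsAntidiagonal, C * (n:ℝ) ^ (-δ') := by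
          refine Finset.sum_le_sum fun x hx => ?_
          obtain ⟨e1, e2⟩ := snd_ne_zero_of_mem hx
          have e3 := (Nat.mem_divisorsAntidiagonal.mp hx).1
          rw [norm_mul, Complex.norm_natCast_cpow_of_pos (Nat.pos_of_ne_zero e1), ← e3]
          push_cast
          rw [Real.mul_rpow (by positivity) (by positivity)]
          have e4 : (1:ℝ) ≤ x.1 := by exact_mod_cast Nat.pos_of_ne_zero e1
          have e5 : (x.1:ℝ) ^ (-a 0).re ≤ (x.1:ℝ) ^ (-δ') := by
            apply Real.rpow_le_rpow_of_exponent_le e4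
            simpa using (h2 0).le
          calc _ ≤ (x.1:ℝ) ^ (-δ') * (C * (x.2:ℝ) ^ (-δ')) :=
                mul_le_mul e5 (hb _ e2) (norm_nonneg _) (by positivity)
            _ = _ := by ring
      _ = (n.divisors.card : ℝ) * (C * (n:ℝ) ^ (-δ')) := by
          rw [Finset.sum_const, nsmul_eq_mul, ← Nat.map_div_right_divisors, Finset.card_map]
      _ ≤ (D * (n:ℝ) ^ (δ' - δ)) * (C * (n:ℝ) ^ (-δ')) :=
          mul_le_mul_of_nonneg_right (hd n hn) (by positivity)
      _ = _ := by
          have : (n:ℝ) ^ (-δ) = (n:ℝ) ^ (δ' - δ) * (n:ℝ) ^ (-δ') := by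
            rw [← Real.rpow_add hn']; congr 1; ring
          rw [this]; ring

lemma exists_lower {k : ℕ} (a : Fin k → ℂ) (ha : ∀ i, 0 < (a i).re) :
    ∃ δ : ℝ, 0 < δ ∧ ∀ i, δ < (a i).re := by
  rcases isEmpty_or_nonempty (Fin k) with h | h
  · exact ⟨1, one_pos, fun i => (IsEmpty.false i).elim⟩
  · obtain ⟨i₀, _, hi₀⟩ := Finset.exists_min_image Finset.univ (fun i => (a i).re)
      Finset.univ_nonempty
    obtain ⟨δ', h1, h2⟩ := exists_between (ha i₀)
    exact ⟨δ', h1, fun i => h2.trans_le (hi₀ i (Finset.mem_univ _))⟩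

lemma summable_main {k l : ℕ} (a : Fin k → ℂ) (b : Fin l → ℂ)
    (ha : ∀ i, 0 < (a i).re) (hb : ∀ j, 0 < (b j).re) :
    Summable (fun n : ℕ => ‖sigmaShift a n * sigmaShift b n / (n : ℂ)‖) := by
  obtain ⟨δ, hδ, h1⟩ := exists_lower a ha
  obtain ⟨C, hC, hc⟩ := sigmaShift_bound a δ h1
  obtain ⟨D, hD, hd⟩ := sigmaShift_bound b 0 hb
  have hs : Summable (fun n : ℕ => C * D * (n:ℝ) ^ (-1 - δ)) :=
    (Real.summable_nat_rpow.mpr (by linarith)).mul_left _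
  refine hs.of_nonneg_of_le (fun _ => norm_nonneg _) fun n => ?_
  by_cases hn : n = 0
  · subst hn; simp; positivity
  have hn' : (0:ℝ) < n := by exact_mod_cast Nat.pos_of_ne_zero hn
  rw [norm_div, norm_mul, Complex.norm_natCast, div_le_iff₀ hn']
  calc _ ≤ (C * (n:ℝ) ^ (-δ)) * (D * (n:ℝ) ^ (-(0:ℝ))) :=
        mul_le_mul (hc n hn) (hd n hn) (norm_nonneg _) (by positivity)
    _ = _ := by
        have : (n:ℝ) ^ (-δ) = (n:ℝ) ^ (-1 - δ) * n := by
          rw [← Real.rpow_add_one hn'.ne']; congr 1; ring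
        rw [this, neg_zero, Real.rpow_zero]; ring

/-- Absolutely convergent products are stable under multiplication. -/
lemma summable_mul_sub_one {ι : Type*} {f g : ι → ℂ} (hf : Summable (fun p => ‖f p - 1‖))
    (hg : Summable (fun p => ‖g p - 1‖)) : Summable (fun p => ‖f p * g p - 1‖) := by
  have h : Summable (fun p => ‖f p - 1‖ * ‖g p - 1‖) :=
    (hf.mul_of_nonneg hg (fun _ => norm_nonneg _) (fun _ => norm_nonneg _)).comp_injective
      (i := fun p => (p, p)) (fun _ _ h => (Prod.mk.inj h).1)
  refine ((h.add hf).add hg).of_nonneg_of_le (fun _ => norm_nonneg _) fun p => ?_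
  have : f p * g p - 1 = (f p - 1) * (g p - 1) + (f p - 1) + (g p - 1) := by ring
  rw [this, ← norm_mul]
  exact (norm_add_le _ _).trans (by gcongr; exact norm_add_le _ _)

lemma summable_prod_sub_one {ι κ : Type*} (s : Finset κ) {f : κ → ι → ℂ}
    (hf : ∀ i ∈ s, Summable (fun p => ‖f i p - 1‖)) :
    Summable (fun p => ‖(∏ i ∈ s, f i p) - 1‖) := by
  classical
  induction s using Finset.induction with
  | empty => simp
  | insert i s hi ih =>
    simp only [Finset.prod_insert hi]
    exact summable_mul_sub_one (hf i (Finset.mem_insert_self _ _))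
      (ih fun j hj => hf j (Finset.mem_insert_of_mem hj))

lemma mult_of_summable {ι : Type*} {f : ι → ℂ} (hf : Summable (fun p => ‖f p - 1‖)) :
    Multipliable f := by
  simpa using multipliable_one_add_of_summable hf

/-- for shifts with positive real parts, `Σ σ_I(n)σ_J(n)/n` converges
absolutely, the Euler product `A(I,J)` converges absolutely, and
`Σ σ_I(n)σ_J(n)/n = A(I,J) Π_{i,j} ζ(1+a_i+b_j)`. -/
theorem statement14 {k l : ℕ} (a : Fin k → ℂ) (b : Fin l → ℂ)
    (ha : ∀ i, 0 < (a i).re) (hb : ∀ j, 0 < (b j).re) :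
    Summable (fun n : ℕ => ‖sigmaShift a (n+1) * sigmaShift b (n+1) / ((n+1 : ℕ) : ℂ)‖) ∧
    Multipliable (fun p : Nat.Primes =>
      (∏ i : Fin k, ∏ j : Fin l, (1 - ((p : ℕ) : ℂ) ^ (-(1:ℂ) - a i - b j))) *
        ∑' u : ℕ, sigmaShift a ((p : ℕ) ^ u) * sigmaShift b ((p : ℕ) ^ u) /
          ((((p : ℕ) ^ u : ℕ)) : ℂ)) ∧
    Summable (fun p : Nat.Primes =>
      ‖(∏ i : Fin k, ∏ j : Fin l, (1 - ((p : ℕ) : ℂ) ^ (-(1:ℂ) - a i - b j))) *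
        (∑' u : ℕ, sigmaShift a ((p : ℕ) ^ u) * sigmaShift b ((p : ℕ) ^ u) /
          ((((p : ℕ) ^ u : ℕ)) : ℂ)) - 1‖) ∧
    (∑' n : ℕ, sigmaShift a (n+1) * sigmaShift b (n+1) / ((n+1 : ℕ) : ℂ))
      = AEuler a b * Zfun a b := by
  have hS := summable_main a b ha hb
  set F : ℕ → ℂ := fun n => sigmaShift a n * sigmaShift b n / (n : ℂ) with hF
  have F0 : F 0 = 0 := by simp [hF]
  have F1 : F 1 = 1 := by simp [hF, sigmaShift_one]
  have Fm : ∀ {m n : ℕ}, Nat.Coprime m n → F (m * n) = F m * F n := by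
    intro m n h
    by_cases hm : m = 0
    · subst hm; simp [F0]
    by_cases hn : n = 0
    · subst hn; simp [F0]
    simp only [hF]
    rw [sigmaShift_mul a hm hn h, sigmaShift_mul b hm hn h]
    push_cast
    rw [mul_mul_mul_comm, mul_div_mul_comm]
  have hE := EulerProduct.eulerProduct_hasProd F1 Fm hS F0
  -- absolute convergence of the Euler product of `F`
  have hEs : Summable (fun p : Nat.Primes => ‖(∑' u : ℕ, F ((p : ℕ) ^ u)) - 1‖) := by
    have hinj : Function.Injective (fun x : Nat.Primes × ℕ => (x.1 : ℕ) ^ (x.2 + 1)) := by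
      rintro ⟨p, u⟩ ⟨q, v⟩ h
      have h' : (p : ℕ) ^ (u + 1) = (q : ℕ) ^ (v + 1) := h
      obtain ⟨h1, h2⟩ := Nat.Prime.pow_inj p.2 q.2 h'
      exact Prod.ext (Subtype.ext h1) h2
    have h2 : Summable (fun x : Nat.Primes × ℕ => ‖F ((x.1 : ℕ) ^ (x.2 + 1))‖) :=
      hS.comp_injective hinj
    have h3 := h2.prod
    refine h3.of_nonneg_of_le (fun _ => norm_nonneg _) fun p => ?_
    have h4 : Summable (fun u : ℕ => ‖F ((p : ℕ) ^ u)‖) :=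
      hS.comp_injective (Nat.pow_right_injective p.2.two_le)
    rw [h4.of_norm.tsum_eq_zero_add, pow_zero, F1, add_sub_cancel_left]
    exact norm_tsum_le_tsum_norm (h2.prod_factor p)
  have hX : ∀ i j, Summable (fun p : Nat.Primes =>
      ‖(1 - ((p : ℕ) : ℂ) ^ (-(1:ℂ) - a i - b j)) - 1‖) := by
    intro i j
    have h1 : Summable (fun n : ℕ => (n:ℝ) ^ (-1 - (a i).re - (b j).re)) :=
      Real.summable_nat_rpow.mpr (by linarith [ha i, hb j])
    have h2 := h1.comp_injective (Subtype.val_injective (p := fun n : ℕ => n.Prime))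
    refine h2.congr fun p => ?_
    rw [sub_sub_cancel_left, norm_neg, Complex.norm_natCast_cpow_of_pos p.2.pos]
    simp
  have hP := summable_prod_sub_one (ι := Nat.Primes) (Finset.univ : Finset (Fin k))
    (f := fun i p => ∏ j : Fin l, (1 - ((p : ℕ) : ℂ) ^ (-(1:ℂ) - a i - b j)))
    (fun i _ => summable_prod_sub_one _ fun j _ => hX i j)
  have hPE := summable_mul_sub_one hP hEs
  refine ⟨(summable_nat_add_iff (f := fun n => ‖F n‖) 1).mpr hS, ?_, ?_, ?_⟩
  · exact mult_of_summable hPE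
  · exact hPE
  have hsum : (∑' n : ℕ, sigmaShift a (n+1) * sigmaShift b (n+1) / ((n+1 : ℕ) : ℂ))
      = ∑' n, F n := by
    have hS' : Summable F := hS.of_norm
    rw [hS'.tsum_eq_zero_add, F0, zero_add]
  rw [hsum]
  have hA : AEuler a b = (∏' p : Nat.Primes, ∏ i : Fin k, ∏ j : Fin l,
      (1 - ((p : ℕ) : ℂ) ^ (-(1:ℂ) - a i - b j))) * ∑' n, F n := by
    rw [← hE.tprod_eq]
    exact (mult_of_summable hP).tprod_mul hE.multipliable
  have hZ : HasProd (fun p : Nat.Primes => ∏ i : Fin k, ∏ j : Fin l,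
      (1 - ((p : ℕ) : ℂ) ^ (-(1:ℂ) - a i - b j))⁻¹) (Zfun a b) := by
    refine hasProd_prod fun i _ => hasProd_prod fun j _ => ?_
    have := riemannZeta_eulerProduct_hasProd (s := 1 + a i + b j)
      (by simp; linarith [ha i, hb j])
    convert this using 5
    ring
  have hone : (∏' p : Nat.Primes, ∏ i : Fin k, ∏ j : Fin l,
      (1 - ((p : ℕ) : ℂ) ^ (-(1:ℂ) - a i - b j))) * Zfun a b = 1 := by
    have h1 := (mult_of_summable hP).hasProd.mul hZ
    refine h1.unique ?_
    convert hasProd_one using 2 with p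
    rw [← Finset.prod_mul_distrib]
    refine Finset.prod_eq_one fun i _ => ?_
    rw [← Finset.prod_mul_distrib]
    refine Finset.prod_eq_one fun j _ => mul_inv_cancel₀ ?_
    intro h0
    have h2 : ((p : ℕ) : ℂ) ^ (-(1:ℂ) - a i - b j) = 1 := (sub_eq_zero.mp h0).symm
    have h3 := congrArg norm h2
    rw [Complex.norm_natCast_cpow_of_pos p.2.pos, norm_one] at h3
    have h4 : ((p:ℕ):ℝ) ^ (-(1:ℂ) - a i - b j).re < 1 :=
      Real.rpow_lt_one_of_one_lt_of_neg (by exact_mod_cast p.2.one_lt)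
        (by simp; linarith [ha i, hb j])
    exact h4.ne h3
  rw [hA, mul_right_comm, hone, one_mul]

end CHN
end
end
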